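/- arXiv:1108.4671 — 2 statements merged into one kernel-verified Lean document; each statement's English description precedes it below -/
import Mathlib

section
/- The full braid group of two points on the 2-sphere is isomorphic to Z/2Z; that is, the fundamental group of the unordered configuration space C_2(S^2) is cyclic of order two. -/
open Metric

/-- The 2-sphere as the unit sphere in `ℝ³`. -/
noncomputable abbrev Sphere2 : Type := Metric.sphere (0 : EuclideanSpace ℝ (Fin 3)) 1

/-- The ordered configuration space of two distinct points on the 2-sphere. -/
abbrev OrderedConfig2Sphere : Type := {p : Sphere2 × Sphere2 // p.1 ≠ p.2}

/-- The relation identifying `(x, y)` with `(y, x)`. -/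
def configSwapRel (p q : OrderedConfig2Sphere) : Prop :=
  q.1 = p.1 ∨ q.1 = (p.1.2, p.1.1)

/-- The unordered configuration space `C₂(S²)`: the quotient of `F₂(S²)` by the
`ℤ/2`-action swapping the two coordinates. -/
def UnorderedConfig2Sphere : Type := Quot configSwapRel

noncomputable instance : TopologicalSpace UnorderedConfig2Sphere := by
  unfold UnorderedConfig2Sphere; infer_instance

open scoped unitInterval

section Normalization

variable {X E : Type*} [TopologicalSpace X] [NormedAddCommGroup E] [NormedSpace ℝ E]

/-- Radial projection of a nowhere vanishing continuous map to the unit sphere. -/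
noncomputable def ContinuousMap.normalizeToSphere (f : C(X, E)) (hf : ∀ x, f x ≠ 0) :
    C(X, sphere (0 : E) 1) where
  toFun x := ⟨‖f x‖⁻¹ • f x, by simp [norm_smul, hf x]⟩
  continuous_toFun := by
    refine Continuous.subtype_mk (Continuous.smul (Continuous.inv₀ (by fun_prop) ?_) (by fun_prop)) _
    simpa using hf

@[simp]
theorem ContinuousMap.coe_normalizeToSphere (f : C(X, E)) (hf : ∀ x, f x ≠ 0) (x : X) :
    (f.normalizeToSphere hf x : E) = ‖f x‖⁻¹ • f x := rfl

/-- If the segment from a unit vector `y` to the antipode `-x` of a unit vector `x` meets the ray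
spanned by `x`, then `y = x`. -/
theorem eq_of_segment_neg_eq_smul {x y : E} (hx : ‖x‖ = 1) (hy : ‖y‖ = 1) {t c : ℝ}
    (ht₀ : 0 ≤ t) (ht₁ : t ≤ 1) (hc : 0 ≤ c) (h : (1 - t) • y + t • (-x) = c • x) : y = x := by
  have h' : (1 - t) • y = (c + t) • x := by
    rw [add_smul, ← h]; module
  have hn := congrArg norm h'
  rw [norm_smul, norm_smul, hx, hy, Real.norm_of_nonneg (by linarith),
    Real.norm_of_nonneg (by linarith)] at hn
  have hpos : 1 - t ≠ 0 := by intro h0; linarith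
  refine smul_right_injective E hpos ?_
  simp only [h']
  congr 1
  linarith

end Normalization

section Sphere

variable {E : Type*} [NormedAddCommGroup E]

theorem Path.exists_contDiff_dist_lt [NormedSpace ℝ E] {x y : E} (γ : Path x y) {ε : ℝ}
    (hε : 0 < ε) : ∃ q : ℝ → E, ContDiff ℝ 1 q ∧ q 0 = x ∧ q 1 = y ∧
      ∀ t : I, dist (q t) (γ t) < ε := by
  have h := Metric.tendsto_atTop.1 (bernsteinApproximation_uniform γ.toContinuousMap) ε hε
  obtain ⟨N, hN⟩ := h
  have hdist := hN (N + 1) (by omega)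
  have hq (t : I) : bernsteinApproximation (N + 1) γ.toContinuousMap t =
      ∑ k : Fin (N + 1 + 1),
        (((N + 1).choose k : ℝ) * (t : ℝ) ^ (k : ℕ) * (1 - (t : ℝ)) ^ (N + 1 - k)) •
          γ (bernstein.z k) := by
    simp [bernsteinApproximation.apply, bernstein_apply]
  refine ⟨fun t ↦ ∑ k : Fin (N + 1 + 1),
    (((N + 1).choose k : ℝ) * t ^ (k : ℕ) * (1 - t) ^ (N + 1 - k)) • γ (bernstein.z k),
    by fun_prop, ?_, ?_, fun t ↦ ?_⟩
  · simpa using (hq 0).symm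
  · simpa using (hq 1).symm
  · simp only [← hq]
    exact (ContinuousMap.dist_apply_le_dist t).trans_lt hdist

theorem isSimplyConnected_sphere_compl_singleton [InnerProductSpace ℝ E]
    (v : sphere (0 : E) 1) : IsSimplyConnected ({v}ᶜ : Set (sphere (0 : E) 1)) := by
  rw [← range_stereographic_symm (norm_eq_of_mem_sphere v) v.2, ← Set.image_univ,
    (isOpenEmbedding_stereographic_symm _).isEmbedding.isSimplyConnected_image]
  exact (Homeomorph.Set.univ _).toHomotopyEquiv.simplyConnectedSpace

theorem Path.homotopic_refl_of_notMem_range [InnerProductSpace ℝ E]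
    {x v : sphere (0 : E) 1} (γ : Path x x) (hv : ∀ t, γ t ≠ v) :
    γ.Homotopic (Path.refl x) :=
  ((isSimplyConnected_iff_exists_homotopy_refl_forall_mem.1
    (isSimplyConnected_sphere_compl_singleton v)).2 x γ hv).nonempty

theorem ContDiff.exists_forall_smul_ne [NormedSpace ℝ E] [FiniteDimensional ℝ E]
    (hE : 2 < Module.finrank ℝ E) {q : ℝ → E} (hq : ContDiff ℝ 1 q) :
    ∃ w : E, ∀ r s : ℝ, r • q s ≠ w := by
  have hF : ContDiff ℝ 1 (fun p : ℝ × ℝ ↦ p.1 • q p.2) := by fun_prop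
  obtain ⟨w, hw⟩ := (hF.dense_compl_range_of_finrank_lt_finrank (by simpa using hE)).nonempty
  exact ⟨w, fun r s h ↦ hw ⟨(r, s), h⟩⟩

theorem Path.homotopic_refl_of_two_lt_finrank [InnerProductSpace ℝ E] [FiniteDimensional ℝ E]
    (hE : 2 < Module.finrank ℝ E) {x : sphere (0 : E) 1} (γ : Path x x) :
    γ.Homotopic (Path.refl x) := by
  obtain ⟨q, hq, hq₀, hq₁, hqγ⟩ :=
    (γ.map continuous_subtype_val).exists_contDiff_dist_lt one_pos
  have hne (p : I × I) : AffineMap.lineMap (γ p.2 : E) (q p.2) (p.1 : ℝ) ≠ 0 := by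
    intro h
    have h₁ := dist_lineMap_left (𝕜 := ℝ) (γ p.2 : E) (q p.2) (p.1 : ℝ)
    have h₂ := hqγ p.2
    have h₃ : dist (γ p.2 : E) 0 = 1 := (γ p.2).2
    rw [h, dist_comm, h₃, dist_comm, Real.norm_of_nonneg p.1.2.1] at h₁
    rw [Path.map_coe, Function.comp_apply] at h₂
    nlinarith [p.1.2.2, dist_nonneg (x := q p.2) (y := (γ p.2 : E))]
  let F : C(I × I, sphere (0 : E) 1) := ContinuousMap.normalizeToSphere
    ⟨fun p ↦ AffineMap.lineMap (γ p.2 : E) (q p.2) (p.1 : ℝ), by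
      have := hq.continuous
      simp only [AffineMap.lineMap_apply_module]
      fun_prop⟩ hne
  let δ : Path x x :=
    { toFun t := F (1, t)
      continuous_toFun := by fun_prop
      source' := by ext1; simp [F, hq₀]
      target' := by ext1; simp [F, hq₁] }
  have hγδ : γ.Homotopic δ := ⟨{
    toContinuousMap := F
    map_zero_left t := by ext1; simp [F]
    map_one_left t := rfl
    prop' t := by
      rintro s (rfl | rfl)
      · ext1; simp [F, hq₀]
      · ext1; simp [F, hq₁] }⟩
  obtain ⟨w, hw⟩ := hq.exists_forall_smul_ne hE
  have hw₀ : w ≠ 0 := fun h ↦ hw 0 0 (by simp [h])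
  refine hγδ.trans (δ.homotopic_refl_of_notMem_range
    (v := ⟨‖w‖⁻¹ • w, by simp [norm_smul, hw₀]⟩) fun t h ↦ hw (‖w‖ * ‖q t‖⁻¹) t ?_)
  have h' : ‖q t‖⁻¹ • q t = ‖w‖⁻¹ • w := by simpa [δ, F] using congrArg Subtype.val h
  rw [mul_smul, h', smul_inv_smul₀ (norm_ne_zero_iff.2 hw₀)]

theorem simplyConnectedSpace_sphere [InnerProductSpace ℝ E] [FiniteDimensional ℝ E]
    (hE : 2 < Module.finrank ℝ E) : SimplyConnectedSpace (sphere (0 : E) 1) :=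
  simply_connected_iff_loops_nullhomotopic.2
    ⟨isPathConnected_iff_pathConnectedSpace.1 <| isPathConnected_sphere
      (by rw [← Module.finrank_eq_rank]; exact_mod_cast (by omega : 1 < Module.finrank ℝ E))
      0 zero_le_one, fun _ γ ↦ γ.homotopic_refl_of_two_lt_finrank hE⟩

end Sphere

namespace OrderedConfig2Sphere

/-- The homotopy moving the second point away from the first one along a great circle, from
`(x, y)` to `(x, -x)`. -/
noncomputable def antipodalHomotopyMap : C(I × OrderedConfig2Sphere, OrderedConfig2Sphere) :=
  let f : C(I × OrderedConfig2Sphere, EuclideanSpace ℝ (Fin 3)) :=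
    ⟨fun p ↦ (1 - (p.1 : ℝ)) • (p.2.1.2 : EuclideanSpace ℝ (Fin 3)) +
      (p.1 : ℝ) • (-(p.2.1.1 : EuclideanSpace ℝ (Fin 3))), by fun_prop⟩
  have key (p : I × OrderedConfig2Sphere) (c : ℝ) (hc : 0 ≤ c) :
      f p ≠ c • (p.2.1.1 : EuclideanSpace ℝ (Fin 3)) := fun h ↦
    p.2.2 (Subtype.ext (eq_of_segment_neg_eq_smul (norm_eq_of_mem_sphere _)
      (norm_eq_of_mem_sphere _) p.1.2.1 p.1.2.2 hc h)).symm
  have hf (p) : f p ≠ 0 := by simpa using key p 0 le_rfl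
  { toFun p := ⟨(p.2.1.1, f.normalizeToSphere hf p), fun h ↦ by
      refine key p ‖f p‖ (norm_nonneg _) ?_
      have h' := congrArg Subtype.val h
      simp only [ContinuousMap.coe_normalizeToSphere] at h'
      rw [h', smul_inv_smul₀ (norm_ne_zero_iff.2 (hf p))]⟩
    continuous_toFun := by fun_prop }

/-- The first projection from the ordered configuration space of two points in the sphere is a
homotopy equivalence, with inverse `x ↦ (x, -x)`. -/
noncomputable def homotopyEquivSphere :
    ContinuousMap.HomotopyEquiv OrderedConfig2Sphere Sphere2 where
  toFun := ⟨fun p ↦ p.1.1, by fun_prop⟩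
  invFun := ⟨fun x ↦ ⟨(x, -x), ne_neg_of_mem_unit_sphere ℝ x⟩, by fun_prop⟩
  left_inv := .symm ⟨{
    toContinuousMap := antipodalHomotopyMap
    map_zero_left p := by
      ext1; ext1
      · rfl
      · ext1; simp [antipodalHomotopyMap]
    map_one_left p := by
      ext1; ext1
      · rfl
      · ext1; simp [antipodalHomotopyMap] }⟩
  right_inv := .refl _

instance : SimplyConnectedSpace OrderedConfig2Sphere :=
  have : SimplyConnectedSpace Sphere2 := simplyConnectedSpace_sphere (by simp)
  homotopyEquivSphere.simplyConnectedSpace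

/-- Exchange of the two points of a configuration. -/
def swap (p : OrderedConfig2Sphere) : OrderedConfig2Sphere := ⟨(p.1.2, p.1.1), p.2.symm⟩

@[simp]
theorem swap_swap (p : OrderedConfig2Sphere) : p.swap.swap = p := rfl

theorem swap_ne (p : OrderedConfig2Sphere) : p.swap ≠ p := fun h ↦
  p.2 (congrArg (fun q : OrderedConfig2Sphere ↦ q.1.2) h)

theorem continuous_swap : Continuous swap := by
  unfold swap; fun_prop

noncomputable instance : MulAction (Multiplicative (ZMod 2)) OrderedConfig2Sphere where
  smul g p := if g = 1 then p else swap p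
  one_smul _ := if_pos rfl
  mul_smul g h p := by
    have key : ∀ g h : Multiplicative (ZMod 2), g ≠ 1 → (g * h = 1 ↔ h ≠ 1) := by decide
    change (if g * h = 1 then p else swap p) =
      if g = 1 then (if h = 1 then p else swap p) else swap (if h = 1 then p else swap p)
    by_cases hg : g = 1
    · simp [hg]
    · simp only [key g h hg, hg]
      by_cases hh : h = 1 <;> simp [hh]

theorem smul_def (g : Multiplicative (ZMod 2)) (p : OrderedConfig2Sphere) :
    g • p = if g = 1 then p else p.swap := rfl

theorem mem_orbit_iff {p q : OrderedConfig2Sphere} :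
    p ∈ MulAction.orbit (Multiplicative (ZMod 2)) q ↔ p = q ∨ p = q.swap := by
  constructor
  · rintro ⟨g, rfl⟩
    by_cases hg : g = 1 <;> simp [smul_def, hg]
  · rintro (rfl | rfl)
    · exact MulAction.mem_orbit_self _
    · exact ⟨Multiplicative.ofAdd 1, if_neg (by decide)⟩

theorem equivalence_configSwapRel : Equivalence configSwapRel where
  refl _ := .inl rfl
  symm := by rintro p q (h | h) <;> simp [configSwapRel, h]
  trans := by rintro p q r (h | h) (h' | h') <;> simp [configSwapRel, h, h']

theorem mk_eq_mk_iff {p q : OrderedConfig2Sphere} :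
    Quot.mk configSwapRel p = Quot.mk configSwapRel q ↔
      p ∈ MulAction.orbit (Multiplicative (ZMod 2)) q := by
  rw [eq_comm, equivalence_configSwapRel.quot_mk_eq_iff, mem_orbit_iff, Subtype.ext_iff,
    Subtype.ext_iff]
  rfl

theorem isQuotientCoveringMap_mk :
    IsQuotientCoveringMap (Quot.mk configSwapRel : OrderedConfig2Sphere → UnorderedConfig2Sphere)
      (Multiplicative (ZMod 2)) where
  toIsQuotientMap := isQuotientMap_quot_mk
  continuous_const_smul g := by
    by_cases hg : g = 1
    · simpa [smul_def, hg] using continuous_id'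
    · simpa [smul_def, hg] using continuous_swap
  apply_eq_iff_mem_orbit := mk_eq_mk_iff
  disjoint p := by
    obtain ⟨U, V, hU, hV, hpU, hpV, hUV⟩ := t2_separation p.swap_ne.symm
    refine ⟨U ∩ swap ⁻¹' V, Filter.inter_mem (hU.mem_nhds hpU)
      (continuous_swap.continuousAt.preimage_mem_nhds (hV.mem_nhds hpV)), fun g hg ↦ ?_⟩
    by_contra hg₁
    obtain ⟨_, ⟨q, hq, rfl⟩, hq'⟩ := hg
    simp only [smul_def, hg₁, if_false] at hq'
    exact Set.disjoint_left.1 hUV hq'.1 hq.2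

end OrderedConfig2Sphere

/-- The full braid group `B₂(S²)` of two points in the sphere is cyclic of order two:
the fundamental group of the unordered configuration space `C₂(S²)` is `ℤ/2ℤ`. -/
theorem fullBraidGroup_two_sphere_eq_zmod_two (x : UnorderedConfig2Sphere) :
    Nonempty (FundamentalGroup UnorderedConfig2Sphere x ≃* Multiplicative (ZMod 2)) := by
  obtain ⟨p, rfl⟩ := Quot.exists_rep x
  exact ⟨(OrderedConfig2Sphere.isQuotientCoveringMap_mk.fundamentalGroupEquiv ⟨p, rfl⟩).trans
    MulOpposite.opMulEquiv.symm⟩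
end

section
/- There exists an upper triangular 2×2 real matrix T with positive diagonal (namely T = [[1, r],[0,1]] for suitable r), a smooth function g: R^2 → [0,1] of the form g(y) = φ(|y|) with s·φ'(s) ≤ 4, and a point y ∈ R^2 at which the derivative of the map f(y) = (I + g(y)(T − I))y is singular. Concretely, if r·φ'(|y|)·|y|·(y₁y₂)/(y₁²+y₂²) = −1 at some y, then Df_y kills the vector (1,0). -/
open Real

theorem Real.one_add_sq_half_le_cosh (u : ℝ) : 1 + u ^ 2 / 2 ≤ cosh u := by
  have h1 : cosh u = 1 + 2 * sinh (u / 2) ^ 2 := by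
    have h := cosh_two_mul (u / 2)
    rw [mul_div_cancel₀ u two_ne_zero, cosh_sq] at h
    linarith
  have h2 : (u / 2) ^ 2 ≤ sinh (u / 2) ^ 2 := by
    rw [sq_le_sq, abs_sinh]
    exact self_le_sinh_iff.2 (abs_nonneg _)
  rw [h1]; linarith

theorem Real.hasDerivAt_smoothTransition_of_mem_Ioo {x : ℝ} (hx : x ∈ Set.Ioo (0 : ℝ) 1) :
    HasDerivAt smoothTransition
      (exp (-x⁻¹) * exp (-(1 - x)⁻¹) * ((x ^ 2)⁻¹ + ((1 - x) ^ 2)⁻¹) /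
        (exp (-x⁻¹) + exp (-(1 - x)⁻¹)) ^ 2) x := by
  obtain ⟨h0, h1⟩ := hx
  have h1' : 0 < 1 - x := sub_pos.2 h1
  have ha : HasDerivAt (fun t : ℝ => exp (-t⁻¹)) (exp (-x⁻¹) * (x ^ 2)⁻¹) x := by
    simpa using (hasDerivAt_inv h0.ne').neg.exp
  have hb : HasDerivAt (fun t : ℝ => exp (-(1 - t)⁻¹))
      (-(exp (-(1 - x)⁻¹) * ((1 - x) ^ 2)⁻¹)) x := by
    have := (((hasDerivAt_id' x).const_sub 1).fun_inv h1'.ne').fun_neg.exp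
    convert this using 1
    ring
  have hd : exp (-x⁻¹) + exp (-(1 - x)⁻¹) ≠ 0 := by positivity
  refine ((ha.fun_div (ha.fun_add hb) hd).congr_of_eventuallyEq ?_).congr_deriv ?_
  · filter_upwards [Ioo_mem_nhds h0 h1] with t ht
    simp [smoothTransition, expNegInvGlue, not_le.2 ht.1, not_le.2 ht.2]
  · congr 1
    ring

theorem Real.smoothTransition_deriv_le_two (x : ℝ) : deriv smoothTransition x ≤ 2 := by
  rcases le_or_gt x 0 with h0 | h0
  · have : IsLocalMin smoothTransition x := .of_forall fun t => by
      rw [smoothTransition.zero_of_nonpos h0]; exact smoothTransition.nonneg t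
    rw [this.deriv_eq_zero]; norm_num
  rcases le_or_gt 1 x with h1 | h1
  · have : IsLocalMax smoothTransition x := .of_forall fun t => by
      rw [smoothTransition.one_of_one_le h1]; exact smoothTransition.le_one t
    rw [this.deriv_eq_zero]; norm_num
  rw [(hasDerivAt_smoothTransition_of_mem_Ioo ⟨h0, h1⟩).deriv, div_le_iff₀ (by positivity)]
  have h1' : 0 < 1 - x := sub_pos.2 h1
  set u := x⁻¹ - (1 - x)⁻¹ with hu
  set a := exp (-x⁻¹) with ha
  set b := exp (-(1 - x)⁻¹) with hb
  have hc : a * b * (2 * cosh u) = a ^ 2 + b ^ 2 := by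
    have e1 : a * exp u = b := by rw [ha, hb, hu, ← exp_add]; ring_nf
    have e2 : b * exp (-u) = a := by rw [ha, hb, hu, ← exp_add]; ring_nf
    rw [cosh_eq]
    linear_combination b * e1 + a * e2
  have key : (x ^ 2)⁻¹ + ((1 - x) ^ 2)⁻¹ ≤ 2 * (4 + u ^ 2) := by
    rw [hu, ← sub_nonneg]
    have : 2 * (4 + (x⁻¹ - (1 - x)⁻¹) ^ 2) - ((x ^ 2)⁻¹ + ((1 - x) ^ 2)⁻¹) =
        (1 - 2 * (x * (1 - x))) * (2 * x - 1) ^ 2 / (x * (1 - x)) ^ 2 := by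
      field_simp
      ring
    rw [this]
    have : 0 ≤ 1 - 2 * (x * (1 - x)) := by nlinarith [sq_nonneg (2 * x - 1)]
    positivity
  have hab : 0 < a * b := by positivity
  nlinarith [mul_le_mul_of_nonneg_left key hab.le,
    mul_le_mul_of_nonneg_left (one_add_sq_half_le_cosh u) hab.le]

theorem fderiv_shear_apply_single {φ : ℝ → ℝ} (r : ℝ) {y : EuclideanSpace ℝ (Fin 2)}
    (hy : y ≠ 0) (hφ : DifferentiableAt ℝ φ ‖y‖) :
    fderiv ℝ (fun y : EuclideanSpace ℝ (Fin 2) =>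
        y + (φ ‖y‖ * r * y 1) • (EuclideanSpace.single 0 (1 : ℝ))) y (EuclideanSpace.single 0 1) =
      (1 + r * deriv φ ‖y‖ * (y 0 * y 1 / ‖y‖)) • EuclideanSpace.single 0 (1 : ℝ) := by
  have hn : HasFDerivAt (fun z : EuclideanSpace ℝ (Fin 2) => ‖z‖) (‖y‖⁻¹ • innerSL ℝ y) y := by
    have h := (hasStrictFDerivAt_norm_sq y).hasFDerivAt.sqrt (by simpa using hy)
    simp only [sqrt_sq (norm_nonneg _)] at h
    refine h.congr_fderiv ?_
    ext v
    simp
    ring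
  have h1 : HasFDerivAt (fun z : EuclideanSpace ℝ (Fin 2) => z 1)
      (EuclideanSpace.proj 1 : EuclideanSpace ℝ (Fin 2) →L[ℝ] ℝ) y :=
    (EuclideanSpace.proj 1 : EuclideanSpace ℝ (Fin 2) →L[ℝ] ℝ).hasFDerivAt
  have hf := (hasFDerivAt_id y).fun_add
    ((((hφ.hasDerivAt.comp_hasFDerivAt y hn).mul_const r).fun_mul h1).smul_const
      (EuclideanSpace.single 0 (1 : ℝ)))
  have := hf.fderiv
  simp only [id, Function.comp_apply] at this
  rw [this]
  ext i
  fin_cases i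
  · simp [EuclideanSpace.inner_single_right]
    ring
  · simp

/-- The worrisome example: there exist an upper triangular matrix `T = [[1,r],[0,1]]`
(with positive diagonal), a smooth cutoff `g(y) = φ(|y|)` with `s·φ'(s) ≤ 4`, and a
point `y ∈ ℝ²` at which the derivative of `f(y) = (I + g(y)(T − I))y` is singular, so
`f` is not a diffeomorphism. -/
theorem worrisome_example :
    ∃ (r : ℝ) (φ : ℝ → ℝ),
      ContDiff ℝ (⊤ : ℕ∞) φ ∧
      (∀ s : ℝ, 0 ≤ s → φ s ∈ Set.Icc (0 : ℝ) 1) ∧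
      (∀ s ∈ Set.Icc (0 : ℝ) (1 / 2), φ s = 0) ∧
      (∀ s : ℝ, 1 ≤ s → φ s = 1) ∧
      (∀ s : ℝ, 0 ≤ s → s * deriv φ s ≤ 4) ∧
      ∃ y : EuclideanSpace ℝ (Fin 2),
        ¬ Function.Injective
          (fderiv ℝ
            (fun y : EuclideanSpace ℝ (Fin 2) =>
              y + (φ ‖y‖ * r * y 1) • (EuclideanSpace.single 0 (1 : ℝ))) y) := by
  set φ : ℝ → ℝ := fun s => smoothTransition (2 * s - 1) with hφ
  have hsmooth : ContDiff ℝ (⊤ : ℕ∞) φ := smoothTransition.contDiff.comp (by fun_prop)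
  have hdiff : Differentiable ℝ φ := hsmooth.differentiable (by simp)
  have hzero : ∀ s ≤ (1 / 2 : ℝ), φ s = 0 := fun s hs =>
    smoothTransition.zero_of_nonpos (by linarith)
  have hone : ∀ s : ℝ, 1 ≤ s → φ s = 1 := fun s hs =>
    smoothTransition.one_of_one_le (by linarith)
  have hderiv : ∀ s, deriv φ s ≤ 4 := fun s => by
    have hσ : DifferentiableAt ℝ smoothTransition (2 * s - 1) :=
      (smoothTransition.contDiff (n := 1)).differentiable (by simp) _
    have h := (hσ.hasDerivAt.comp s (((hasDerivAt_id s).const_mul 2).sub_const 1)).deriv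
    have h' : deriv φ s = deriv smoothTransition (2 * s - 1) * (2 * 1) := h
    linarith [smoothTransition_deriv_le_two (2 * s - 1)]
  obtain ⟨s, ⟨hs, -⟩, hs'⟩ := exists_deriv_eq_slope φ (by norm_num : (1 / 2 : ℝ) < 1)
    hdiff.continuous.continuousOn hdiff.differentiableOn
  rw [hzero _ le_rfl, hone _ le_rfl] at hs'
  norm_num at hs'
  have hs0 : 0 < s := by linarith
  refine ⟨-25 / (24 * s), φ, hsmooth,
    fun s _ => ⟨smoothTransition.nonneg _, smoothTransition.le_one _⟩,
    fun s hs => hzero s hs.2, hone, fun s hs => ?_, !₂[s * (3 / 5), s * (4 / 5)], ?_⟩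
  · rcases le_or_gt 1 s with h1 | h1
    · have : IsLocalMax φ s := .of_forall fun t => by
        rw [hone s h1]; exact smoothTransition.le_one _
      rw [this.deriv_eq_zero]; norm_num
    · nlinarith [hderiv s]
  · have hnorm : ‖(!₂[s * (3 / 5), s * (4 / 5)] : EuclideanSpace ℝ (Fin 2))‖ = s := by
      rw [EuclideanSpace.norm_eq, sqrt_eq_iff_mul_self_eq (by positivity) hs0.le]
      simp [Fin.sum_univ_two]
      ring
    intro hinj
    have h := fderiv_shear_apply_single (φ := φ) (-25 / (24 * s))
      (norm_pos_iff.1 (hnorm.symm ▸ hs0)) (hdiff _)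
    rw [hnorm, hs'] at h
    have hz : 1 + -25 / (24 * s) * 2 * (s * (3 / 5) * (s * (4 / 5)) / s) = 0 := by
      field_simp
      norm_num
    simp only [Matrix.cons_val_zero, Matrix.cons_val_one] at h
    rw [hz, zero_smul] at h
    have h0 := hinj (h.trans (map_zero _).symm)
    simpa using congrArg (fun v : EuclideanSpace ℝ (Fin 2) => v 0) h0
end
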